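/- Let V be a separable reflexive real Banach space, p ∈ [2, ∞), and let D : V → V* be monotone, hemicontinuous, satisfy ‖D(x)‖_{V*} ≤ K(1 + ‖x‖_V^{p−1}) for all x ∈ V for some K > 0, and satisfy ⟨D(x), x⟩ ≥ C₁‖x‖_V^p − C₂ for all x ∈ V with constants C₁ > 0, C₂ ≥ 0. Suppose in addition that D is strongly monotone: there exist a real normed vector space E, an injective continuous linear map ι : V → E, and a constant C₃ > 0 such that ⟨D(x₁) − D(x₂), x₁ − x₂⟩ ≥ C₃‖ι(x₁ − x₂)‖_E² for all x₁, x₂ ∈ V. Then for every y ∈ V* the equation D(x) = y has exactly one solution x ∈ V. -/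

import Mathlib

open Filter Topology

lemma finite_minty {κ : Type*} [Fintype κ] [Nonempty κ] (a : κ → κ → ℝ)
    (ha : ∀ i j, 0 ≤ a i j + a j i) :
    ∃ l ∈ stdSimplex ℝ κ, ∀ i, 0 ≤ ∑ j, l j * a i j := by
  classical
  by_contra hcon
  push Not at hcon
  let L : (κ → ℝ) →ₗ[ℝ] (κ → ℝ) := Matrix.mulVecLin (Matrix.of a)
  have hL : ∀ l i, L l i = ∑ j, l j * a i j := by
    intro l i
    simp [L, Matrix.mulVec, dotProduct, mul_comm]
  have hLc : Continuous L := L.continuous_of_finiteDimensional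
  have hT : IsClosed {w : κ → ℝ | ∀ i, 0 ≤ w i} := by
    simp only [Set.setOf_forall]
    exact isClosed_iInter fun i => isClosed_le continuous_const (continuous_apply i)
  have hTc : Convex ℝ {w : κ → ℝ | ∀ i, 0 ≤ w i} := by
    intro x hx y hy s t hs ht _ i
    have := mul_nonneg hs (hx i)
    have := mul_nonneg ht (hy i)
    simp only [Pi.add_apply, Pi.smul_apply, smul_eq_mul]
    linarith
  obtain ⟨f, u, v, hfu, huv, hfv⟩ := geometric_hahn_banach_compact_closed
    ((convex_stdSimplex ℝ κ).linear_image L) ((isCompact_stdSimplex ℝ κ).image hLc) hTc hT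
    (by
      rw [Set.disjoint_left]
      rintro _ ⟨l, hl, rfl⟩ hw
      obtain ⟨i, hi⟩ := hcon l hl
      have := hw i
      rw [hL] at this
      linarith)
  have hv0 : v < 0 := by simpa using hfv 0 (by simp)
  set m : κ → ℝ := fun i => f (Pi.single i 1) with hm
  have hf : ∀ w, f w = ∑ i, w i * m i := by
    intro w
    have e : w = ∑ i, w i • (Pi.single i 1 : κ → ℝ) := by
      ext j
      simp [Finset.sum_apply, Pi.single_apply]
    conv_lhs => rw [e]
    simp only [map_sum, map_smul, smul_eq_mul, hm]
  have hm0 : ∀ i, 0 ≤ m i := by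
    intro i
    by_contra h
    push Not at h
    have h1 := hfv ((v / m i) • Pi.single i 1) (by
      intro j
      have : 0 ≤ v / m i := (div_pos_of_neg_of_neg hv0 h).le
      by_cases hj : j = i
      · subst hj; simpa using this
      · simp [hj])
    rw [map_smul, smul_eq_mul, div_mul_cancel₀ _ h.ne] at h1
    exact lt_irrefl _ h1
  have hs : 0 < ∑ i, m i := by
    refine lt_of_le_of_ne (Finset.sum_nonneg fun i _ => hm0 i) fun h => ?_
    have hz := (Finset.sum_eq_zero_iff_of_nonneg (fun i _ => hm0 i)).1 h.symm
    obtain ⟨i⟩ := ‹Nonempty κ›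
    have := hfu _ ⟨_, single_mem_stdSimplex ℝ i, rfl⟩
    rw [hf, Finset.sum_eq_zero (fun j hj => by rw [hz j hj, mul_zero])] at this
    linarith
  have h2 := hfu _ ⟨(∑ i, m i)⁻¹ • m, ⟨fun i => mul_nonneg (inv_nonneg.2 hs.le) (hm0 i), by
    simp only [Pi.smul_apply, smul_eq_mul, ← Finset.mul_sum]
    exact inv_mul_cancel₀ hs.ne'⟩, rfl⟩
  rw [map_smul, map_smul, smul_eq_mul, hf] at h2
  have h3 : 0 ≤ ∑ i, L m i * m i := by
    have e1 : ∑ i, L m i * m i = ∑ i, ∑ j, m i * m j * a i j := by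
      refine Finset.sum_congr rfl fun i _ => ?_
      rw [hL, Finset.sum_mul]
      exact Finset.sum_congr rfl fun j _ => by ring
    have e2 : ∑ i, L m i * m i = ∑ i, ∑ j, m i * m j * a j i := by
      rw [e1, Finset.sum_comm]
      exact Finset.sum_congr rfl fun i _ => Finset.sum_congr rfl fun j _ => by ring
    have e3 : 0 ≤ ∑ i, ∑ j, (m i * m j * a i j + m i * m j * a j i) := by
      refine Finset.sum_nonneg fun i _ => Finset.sum_nonneg fun j _ => ?_
      rw [← mul_add]
      exact mul_nonneg (mul_nonneg (hm0 i) (hm0 j)) (ha i j)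
    simp only [Finset.sum_add_distrib] at e3
    linarith
  have := mul_nonneg (inv_nonneg.2 hs.le) h3
  linarith

/-- Existence for the weak (Minty) variational inequality on a ball. -/
lemma exists_minty_ball {V : Type*} [NormedAddCommGroup V] [NormedSpace ℝ V]
    (hrefl : Function.Surjective (NormedSpace.inclusionInDoubleDual ℝ V))
    (A : V → V →L[ℝ] ℝ) (hmono : ∀ x y : V, 0 ≤ (A x - A y) (x - y))
    (R : ℝ) (hR : 0 < R) :
    ∃ x : V, ‖x‖ ≤ R ∧ ∀ z : V, ‖z‖ ≤ R → A z x ≤ A z z := by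
  classical
  have hJ : ∀ (x : V) (g : V →L[ℝ] ℝ),
      NormedSpace.inclusionInDoubleDual ℝ V x g = g x := fun x g => rfl
  let S : {z : V // ‖z‖ ≤ R} → Set (WeakDual ℝ (StrongDual ℝ V)) :=
    fun z => {ξ | ξ (A z.1) ≤ A z.1 z.1}
  have hS : ∀ z, IsClosed (S z) := fun z =>
    isClosed_le (WeakDual.eval_continuous _) continuous_const
  obtain ⟨ξ, hξ, hξS⟩ := (WeakDual.isCompact_closedBall (𝕜 := ℝ) (E := StrongDual ℝ V)
      0 R).inter_iInter_nonempty S hS (by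
    intro u
    suffices h : ∃ x : V, ‖x‖ ≤ R ∧ ∀ z ∈ u, A z.1 x ≤ A z.1 z.1 by
      obtain ⟨x, hx, hxu⟩ := h
      refine ⟨StrongDual.toWeakDual (NormedSpace.inclusionInDoubleDual ℝ V x), ?_, ?_⟩
      · simp only [Set.mem_preimage, mem_closedBall_zero_iff]
        exact (NormedSpace.double_dual_bound ℝ V x).trans hx
      · simp only [Set.mem_iInter]
        exact fun z hz => hxu z hz
    rcases u.eq_empty_or_nonempty with rfl | hu
    · exact ⟨0, by simpa using hR.le, by simp⟩
    haveI : Nonempty u := hu.to_subtype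
    obtain ⟨l, hl, h⟩ := finite_minty (κ := u) (fun i j => A i.1.1 (i.1.1 - j.1.1)) (by
      intro i j
      have := hmono i.1.1 j.1.1
      simp only [ContinuousLinearMap.sub_apply, map_sub] at this ⊢
      linarith)
    refine ⟨∑ j, l j • j.1.1, ?_, ?_⟩
    · have := (convex_closedBall (0 : V) R).sum_mem (t := Finset.univ) (w := l)
        (z := fun j : u => j.1.1) (fun i _ => hl.1 i) hl.2 (fun i _ => by simpa using i.1.2)
      simpa using this
    · intro z hz
      have := h ⟨z, hz⟩
      simp only [map_sub, mul_sub, Finset.sum_sub_distrib, ← Finset.sum_mul, hl.2] at this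
      simp only [map_sum, map_smul, smul_eq_mul]
      linarith)
  obtain ⟨x, hx⟩ := hrefl (WeakDual.toStrongDual ξ)
  refine ⟨x, ?_, fun z hz => ?_⟩
  · have h1 : ‖WeakDual.toStrongDual ξ‖ ≤ R := by simpa using hξ
    rw [← hx] at h1
    rwa [← (NormedSpace.inclusionInDoubleDualLi ℝ (E := V)).norm_map x]
  · have := Set.mem_iInter.1 hξS ⟨z, hz⟩
    rw [← hJ, hx]
    exact this

/-- Proposition 4.2 (uniqueness part): under the additional strong monotonicity
condition, the equation `D x = y` has exactly one solution. -/
theorem stmt_1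
    {V : Type*} [NormedAddCommGroup V] [NormedSpace ℝ V] [CompleteSpace V]
    [TopologicalSpace.SeparableSpace V]
    (hrefl : Function.Surjective (NormedSpace.inclusionInDoubleDual ℝ V))
    (p : ℝ) (hp : 2 ≤ p)
    (D : V → V →L[ℝ] ℝ)
    (hmono : ∀ x y : V, 0 ≤ (D x - D y) (x - y))
    (hhemi : ∀ x y z : V,
      Tendsto (fun ε : ℝ => D (x + ε • y) z) (𝓝 0) (𝓝 (D x z)))
    (K : ℝ) (hK : 0 < K)
    (hgrowth : ∀ x : V, ‖D x‖ ≤ K * (1 + ‖x‖ ^ (p - 1)))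
    (C₁ C₂ : ℝ) (hC₁ : 0 < C₁) (hC₂ : 0 ≤ C₂)
    (hcoer : ∀ x : V, C₁ * ‖x‖ ^ p - C₂ ≤ D x x)
    (E : Type*) [NormedAddCommGroup E] [NormedSpace ℝ E]
    (ι : V →L[ℝ] E) (hι : Function.Injective ι)
    (C₃ : ℝ) (hC₃ : 0 < C₃)
    (hstrong : ∀ x₁ x₂ : V, C₃ * ‖ι (x₁ - x₂)‖ ^ 2 ≤ (D x₁ - D x₂) (x₁ - x₂)) :
    ∀ y : V →L[ℝ] ℝ, ∃! x : V, D x = y := by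
  intro y
  have huniq : ∀ x₁ x₂, D x₁ = y → D x₂ = y → x₁ = x₂ := by
    intro x₁ x₂ h₁ h₂
    have h := hstrong x₁ x₂
    rw [h₁, h₂, sub_self, ContinuousLinearMap.zero_apply] at h
    have h0 : ‖ι (x₁ - x₂)‖ ^ 2 ≤ 0 := by
      by_contra hc
      push Not at hc
      have := mul_pos hC₃ hc
      linarith
    have h1 : ‖ι (x₁ - x₂)‖ = 0 := by
      have := sq_nonneg ‖ι (x₁ - x₂)‖
      exact pow_eq_zero_iff (two_ne_zero) |>.1 (le_antisymm h0 this)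
    have h2 : ι (x₁ - x₂) = ι 0 := by rw [map_zero]; exact norm_eq_zero.1 h1
    exact sub_eq_zero.1 (hι h2)
  suffices hex : ∃ x, D x = y by
    obtain ⟨x, hx⟩ := hex
    exact ⟨x, hx, fun z hz => huniq z x hz hx⟩
  set R : ℝ := 1 + (C₂ + ‖y‖) / C₁ with hRdef
  have hq : 0 ≤ (C₂ + ‖y‖) / C₁ := by positivity
  have hR : 0 < R := by linarith
  obtain ⟨x, hxR, hx⟩ := exists_minty_ball hrefl (fun x => D x - y)
    (fun x z => by simpa using hmono x z) R hR
  have hVI : ∀ w : V, ‖w‖ ≤ R → 0 ≤ (D x - y) (w - x) := by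
    intro w hw
    have hlim : Tendsto (fun ε : ℝ => D (x + ε • (w - x)) (w - x) - y (w - x)) (𝓝[>] 0)
        (𝓝 (D x (w - x) - y (w - x))) :=
      ((hhemi x (w - x) (w - x)).mono_left nhdsWithin_le_nhds).sub_const _
    refine ge_of_tendsto hlim ?_
    filter_upwards [Ioo_mem_nhdsGT (zero_lt_one' ℝ)] with ε hε
    have hball : ‖x + ε • (w - x)‖ ≤ R := by
      have := (convex_closedBall (0 : V) R).add_smul_sub_mem
        (by simpa using hxR) (by simpa using hw) ⟨hε.1.le, hε.2.le⟩
      simpa using this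
    have h := hx _ hball
    have h' : 0 ≤ ε * (D (x + ε • (w - x)) (w - x) - y (w - x)) := by
      rw [map_add, map_smul, smul_eq_mul, ContinuousLinearMap.sub_apply] at h
      simp only [ContinuousLinearMap.sub_apply] at h
      linarith
    exact nonneg_of_mul_nonneg_right h' hε.1
  have hlt : ‖x‖ < R := by
    by_contra hge
    push Not at hge
    have h0 := hVI 0 (by simpa using hR.le)
    simp only [zero_sub, map_neg, ContinuousLinearMap.sub_apply] at h0
    have hc := hcoer x
    have hy : y x ≤ ‖y‖ * ‖x‖ := (le_abs_self _).trans (y.le_opNorm x)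
    have h1 : 1 ≤ ‖x‖ := by linarith
    have hpow : ‖x‖ ^ 2 ≤ ‖x‖ ^ p := by
      rw [← Real.rpow_two]
      exact Real.rpow_le_rpow_of_exponent_le h1 hp
    have hCR : C₁ * R = C₁ + (C₂ + ‖y‖) := by rw [hRdef]; field_simp
    have h2 : C₁ + (C₂ + ‖y‖) ≤ C₁ * ‖x‖ := by
      rw [← hCR]; exact mul_le_mul_of_nonneg_left hge hC₁.le
    have h3 := mul_le_mul_of_nonneg_left hpow hC₁.le
    have h4 := mul_le_mul_of_nonneg_right h2 (norm_nonneg x)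
    have h5 := mul_le_mul_of_nonneg_left h1 (add_nonneg hC₁.le hC₂)
    nlinarith
  refine ⟨x, sub_eq_zero.1 ?_⟩
  have hnn : ∀ w : V, 0 ≤ (D x - y) w := by
    intro w
    have hd : 0 < (R - ‖x‖) / (‖w‖ + 1) := div_pos (by linarith) (by positivity)
    have h := hVI (x + ((R - ‖x‖) / (‖w‖ + 1)) • w) (by
      refine (norm_add_le _ _).trans ?_
      rw [norm_smul, Real.norm_of_nonneg hd.le]
      have : (R - ‖x‖) / (‖w‖ + 1) * ‖w‖ ≤ (R - ‖x‖) / (‖w‖ + 1) * (‖w‖ + 1) :=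
        mul_le_mul_of_nonneg_left (by linarith) hd.le
      rw [div_mul_cancel₀ _ (by positivity)] at this
      linarith)
    rw [add_sub_cancel_left, map_smul, smul_eq_mul] at h
    exact nonneg_of_mul_nonneg_right h hd
  ext w
  have h1 := hnn w
  have h2 := hnn (-w)
  rw [map_neg] at h2
  exact le_antisymm (neg_nonneg.1 h2) h1
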